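/- The set H(1) = {φ ∈ S_G : L_φ is a bijection of G}, where L_φ(x) = φ(x)x, is the group of units of the monoid (S_G, ∗): every φ ∈ H(1) has a two-sided inverse in S_G, and conversely every unit of S_G lies in H(1). -/

import Mathlib

/-- A groupoid in the sense of Hahn: a set with a partially defined product,
an inverse map, and a composability relation. -/
structure GroupoidStr (G : Type*) where
  mul : G → G → G
  inv : G → G
  comp : G → G → Prop
  inv_inv : ∀ x, inv (inv x) = x
  comp_mul_left : ∀ {x y z}, comp x y → comp y z → comp (mul x y) z
  comp_mul_right : ∀ {x y z}, comp x y → comp y z → comp x (mul y z)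
  mul_assoc : ∀ {x y z}, comp x y → comp y z → mul (mul x y) z = mul x (mul y z)
  comp_inv_left : ∀ x, comp (inv x) x
  comp_inv_right : ∀ x, comp x (inv x)
  inv_mul_cancel : ∀ {x y}, comp x y → mul (inv x) (mul x y) = y
  mul_inv_cancel : ∀ {z x}, comp z x → mul (mul z x) (inv x) = z
  /-- `(x, y)` is composable iff `d x = r y`. -/
  comp_iff : ∀ x y, comp x y ↔ mul (inv x) x = mul y (inv y)

namespace GroupoidStr

variable {G : Type*} (𝔾 : GroupoidStr G)

/-- The range map `r x = x * x⁻¹`. -/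
def r (x : G) : G := 𝔾.mul x (𝔾.inv x)

/-- The domain map `d x = x⁻¹ * x`. -/
def d (x : G) : G := 𝔾.mul (𝔾.inv x) x

/-- The set `S_G` of maps `f : G → G` with `d (f x) = r x`. -/
def SG : Set (G → G) := {f | ∀ x, 𝔾.d (f x) = 𝔾.r x}

/-- The set `S'_G` of maps `h : G → G` with `r (h x) = d x`. -/
def SG' : Set (G → G) := {h | ∀ x, 𝔾.r (h x) = 𝔾.d x}

/-- The operation `(f ∗ g) x = g (f x · x) · f x` on `S_G`. -/
def star (f g : G → G) : G → G := fun x => 𝔾.mul (g (𝔾.mul (f x) x)) (f x)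

/-- The operation `(h ⋆ k) x = h x · k (x · h x)` on `S'_G`. -/
def star' (h k : G → G) : G → G := fun x => 𝔾.mul (h x) (k (𝔾.mul x (h x)))

/-- The map `f ↦ f*`, `f* x = (f x⁻¹)⁻¹`. -/
def dagger (f : G → G) : G → G := fun x => 𝔾.inv (f (𝔾.inv x))

/-- `L_φ x = φ x · x`. -/
def L (φ : G → G) : G → G := fun x => 𝔾.mul (φ x) x

/-- `R_ψ x = x · ψ x`. -/
def R (ψ : G → G) : G → G := fun x => 𝔾.mul x (ψ x)

end GroupoidStr

open GroupoidStr

namespace GroupoidStr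

variable {G : Type*} (𝔾 : GroupoidStr G)

theorem d_inv (x : G) : 𝔾.d (𝔾.inv x) = 𝔾.r x := by
  simp only [d, r, 𝔾.inv_inv]

theorem r_mul {x y : G} (h : 𝔾.comp x y) : 𝔾.r (𝔾.mul x y) = 𝔾.r x :=
  ((𝔾.comp_iff _ _).1 (𝔾.comp_mul_right (𝔾.comp_inv_left x) h)).symm.trans (𝔾.d_inv x)

theorem r_mul_self (x : G) : 𝔾.mul (𝔾.r x) x = x := by
  simpa only [r, 𝔾.inv_inv] using 𝔾.mul_inv_cancel (𝔾.comp_inv_right x)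

variable {𝔾}

theorem comp_of_mem_SG {φ : G → G} (hφ : φ ∈ 𝔾.SG) (x : G) : 𝔾.comp (φ x) x :=
  (𝔾.comp_iff _ _).2 (hφ x)

theorem r_L {φ : G → G} (hφ : φ ∈ 𝔾.SG) (x : G) : 𝔾.r (𝔾.L φ x) = 𝔾.r (φ x) :=
  𝔾.r_mul (comp_of_mem_SG hφ x)

/-- `L` turns `∗` into composition, in the opposite order. -/
theorem L_star {φ ψ : G → G} (hφ : φ ∈ 𝔾.SG) (hψ : ψ ∈ 𝔾.SG) (x : G) :
    𝔾.L (𝔾.star φ ψ) x = 𝔾.L ψ (𝔾.L φ x) :=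
  𝔾.mul_assoc ((𝔾.comp_iff _ _).2 ((hψ (𝔾.L φ x)).trans (r_L hφ x))) (comp_of_mem_SG hφ x)

theorem leftInverse_L_of_star_eq_r {φ ψ : G → G} (hφ : φ ∈ 𝔾.SG) (hψ : ψ ∈ 𝔾.SG)
    (h : 𝔾.star φ ψ = 𝔾.r) : Function.LeftInverse (𝔾.L ψ) (𝔾.L φ) := fun x => by
  rw [← L_star hφ hψ, h]
  exact 𝔾.r_mul_self x

end GroupoidStr

theorem stmt13 {G : Type*} (𝔾 : GroupoidStr G) :
    ∀ φ ∈ 𝔾.SG, (Function.Bijective (𝔾.L φ) ↔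
      ∃ ψ ∈ 𝔾.SG, 𝔾.star φ ψ = 𝔾.r ∧ 𝔾.star ψ φ = 𝔾.r) := by
  intro φ hφ
  constructor
  · intro hb
    obtain ⟨M, hl, hr⟩ := Function.bijective_iff_has_inverse.1 hb
    refine ⟨fun y => 𝔾.inv (φ (M y)), fun y => ?_, funext fun x => ?_, funext fun y => ?_⟩
    · rw [d_inv, ← r_L hφ, hr y]
    · change 𝔾.mul (𝔾.inv (φ (M (𝔾.L φ x)))) (φ x) = 𝔾.r x
      rw [hl x]
      exact hφ x
    · obtain ⟨x, rfl⟩ := hb.2 y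
      change 𝔾.mul (φ (𝔾.mul (𝔾.inv (φ (M (𝔾.L φ x)))) (𝔾.mul (φ x) x)))
        (𝔾.inv (φ (M (𝔾.L φ x)))) = 𝔾.r (𝔾.L φ x)
      rw [hl x, 𝔾.inv_mul_cancel (comp_of_mem_SG hφ x), r_L hφ]
      rfl
  · rintro ⟨ψ, hψ, h₁, h₂⟩
    exact Function.bijective_iff_has_inverse.2
      ⟨𝔾.L ψ, leftInverse_L_of_star_eq_r hφ hψ h₁, leftInverse_L_of_star_eq_r hψ hφ h₂⟩
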